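/- arXiv:2002.01518 — 2 statements merged into one kernel-verified Lean document; each statement's English description precedes it below -/
import Mathlib

section
/- Let g_{n+k,n} denote the coefficient of x^n in the transformed Al-Salam–Chihara polynomial p̂_{n+k}(x). Then for all n, k ≥ 0, g_{n+k,n} = Σ_{a+b=k} Σ_{A ⊆ {0,…,n+a−1}, |A|=a} Σ_{B ⊆ {0,…,n+a+b−1}, |B|=b} w_n(A,B), where w_n is the weight defined in the context. -/
noncomputable section

open Finset

/-- The base ring `R = ℤ[α, β, ε₁, ε₂, q]`, with variables
`av = α`, `bv = β`, `e1v = ε₁`, `e2v = ε₂`, `qv = q`. -/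
abbrev R : Type := MvPolynomial (Fin 5) ℤ

def av : R := MvPolynomial.X 0
def bv : R := MvPolynomial.X 1
def e1v : R := MvPolynomial.X 2
def e2v : R := MvPolynomial.X 3
def qv : R := MvPolynomial.X 4

/-- `[n]_q = 1 + q + ⋯ + q^(n-1)`. -/
def qnum (n : ℕ) : R := ∑ i ∈ Finset.range n, qv ^ i

/-- The Gaussian (q-)binomial coefficient. -/
def qbinom : ℕ → ℕ → R
  | _, 0 => 1
  | 0, _ + 1 => 0
  | n + 1, k + 1 => qbinom n k + qv ^ (k + 1) * qbinom n (k + 1)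

/-- `X_i = α q^i + ε₁ [i]_q`. -/
def Xv (i : ℕ) : R := av * qv ^ i + e1v * qnum i

/-- `Y_i = β q^i + ε₂ [i]_q`. -/
def Yv (i : ℕ) : R := bv * qv ^ i + e2v * qnum i

/-- `b_n = (α+β) q^n + (ε₁+ε₂)[n]_q`. -/
def bcoef (n : ℕ) : R := (av + bv) * qv ^ n + (e1v + e2v) * qnum n

/-- `λ_n = ε₁ε₂[n]_q[n-1]_q + (αε₂+βε₁) q^(n-1) [n]_q + αβ(q^(2n-1) - q^(n-1))` (for `n ≥ 1`). -/
def lcoef (n : ℕ) : R :=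
  e1v * e2v * qnum n * qnum (n - 1) + (av * e2v + bv * e1v) * qv ^ (n - 1) * qnum n
    + av * bv * (qv ^ (2 * n - 1) - qv ^ (n - 1))

/-- The transformed Al-Salam-Chihara polynomials. -/
def phat : ℕ → Polynomial R
  | 0 => 1
  | 1 => Polynomial.X + Polynomial.C (bcoef 0)
  | n + 2 => (Polynomial.X + Polynomial.C (bcoef (n + 1))) * phat (n + 1)
      - Polynomial.C (lcoef (n + 1)) * phat n

/-- `g m i` is the coefficient of `x^i` in `p̂_m(x)`. -/
def g (m i : ℕ) : R := (phat m).coeff i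

/-- `B(m)`: the `m`-th smallest element (1-indexed) of `ℤ_{≥0} ∖ B`. -/
def SelN (B : Finset ℕ) (m : ℕ) : ℕ := Nat.nth (fun x => x ∉ B) (m - 1)

/-- `λ_A(j)`: the `j`-th entry (1-indexed) of `λ_A = (i₁, i₂−1, …, i_a−a+1)`
for `A = {i₁ < ⋯ < i_a}`. -/
def lamA (A : Finset ℕ) (j : ℕ) : ℕ := (A.sort (· ≤ ·)).getD (j - 1) 0 - (j - 1)

/-- The weight `w_n(A,B)` of Definition `weight`: writing
`B ∩ {n+b,…,n+b+a−1} = {n+b+a−j_k < ⋯ < n+b+a−j₁}` and `μ = λ_A`,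
`w_n(A,B) = (∏_{i∈A} X_i)(∏_{i∈B∩{0,…,n+b−1}} Y_i)
  (∏_{l=1}^{k} q^{(n+b+a−j_l)−B(μ_{j_l}+l)} Y_{B(μ_{j_l}+l)})`. -/
def wWeight (n a b : ℕ) (A B : Finset ℕ) : R :=
  -- the elements of `B ∩ {n+b,…,n+b+a−1}` in decreasing order; the `(l0+1)`-th largest
  -- is `n+b+a−j_{l0+1}`
  let L := ((B.filter fun x => n + b ≤ x).sort (· ≤ ·)).reverse
  (∏ i ∈ A, Xv i) * (∏ i ∈ B.filter (fun x => x < n + b), Yv i) *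
    ∏ l ∈ Finset.range L.length,
      qv ^ (L.getD l 0 - SelN B (lamA A (n + a + b - L.getD l 0) + (l + 1))) *
        Yv (SelN B (lamA A (n + a + b - L.getD l 0) + (l + 1)))

/-- shift of a finite set by one -/
def sh (B : Finset ℕ) : Finset ℕ := B.map ⟨Nat.succ, Nat.succ_injective⟩

lemma zero_notMem_sh (B : Finset ℕ) : 0 ∉ sh B := by simp [sh]

lemma succ_mem_sh (B : Finset ℕ) (x : ℕ) : x + 1 ∈ sh B ↔ x ∈ B := by simp [sh]

lemma mem_sh (B : Finset ℕ) (y : ℕ) : y ∈ sh B ↔ ∃ x ∈ B, x + 1 = y := by simp [sh]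

lemma range_succ_sh (N : ℕ) : range (N + 1) = insert 0 (sh (range N)) := by
  ext x
  cases x with
  | zero => simp
  | succ x => simp [succ_mem_sh]

lemma insert_top_injOn {M : Type*} [AddCommMonoid M] (f : Finset ℕ → M) (s : Finset ℕ) (x a : ℕ)
    (hx : x ∉ s) :
    ∑ A ∈ powersetCard (a + 1) (insert x s), f A =
      ∑ A ∈ powersetCard a s, f (insert x A) + ∑ A ∈ powersetCard (a + 1) s, f A := by
  rw [powersetCard_succ_insert hx, sum_union, add_comm, sum_image]
  · intro A hA B hB h
    have hA' : x ∉ A := fun h => hx ((mem_powersetCard.1 hA).1 h)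
    have hB' : x ∉ B := fun h => hx ((mem_powersetCard.1 hB).1 h)
    rw [← erase_insert hA', ← erase_insert hB', h]
  · rw [disjoint_left]
    intro A hA hB
    obtain ⟨C, hC, rfl⟩ := mem_image.1 hB
    exact hx ((mem_powersetCard.1 hA).1 (mem_insert_self _ _))

lemma sum_pc_sh {M : Type*} [AddCommMonoid M] (f : Finset ℕ → M) (s : Finset ℕ) (a : ℕ) :
    ∑ A ∈ powersetCard a (sh s), f A = ∑ A ∈ powersetCard a s, f (sh A) := by
  rw [sh, powersetCard_map, sum_map]
  rfl

lemma sum_split {M : Type*} [AddCommMonoid M] (f : Finset ℕ → M) (N a : ℕ) :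
    ∑ A ∈ powersetCard (a + 1) (range (N + 1)), f A =
      ∑ A ∈ powersetCard a (range N), f (insert 0 (sh A)) +
        ∑ A ∈ powersetCard (a + 1) (range N), f (sh A) := by
  rw [range_succ_sh, insert_top_injOn _ _ _ _ (zero_notMem_sh _), sum_pc_sh, sum_pc_sh]

lemma sum_split_top {M : Type*} [AddCommMonoid M] (f : Finset ℕ → M) (N a : ℕ) :
    ∑ A ∈ powersetCard (a + 1) (range (N + 1)), f A =
      ∑ A ∈ powersetCard a (range N), f (insert N A) +
        ∑ A ∈ powersetCard (a + 1) (range N), f A := by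
  rw [range_add_one, insert_top_injOn _ _ _ _ (by simp)]

/-- top part in decreasing order -/
def Lt (c : ℕ) (B : Finset ℕ) : List ℕ := ((B.filter fun x => c ≤ x).sort (· ≤ ·)).reverse

lemma sort_sh (A : Finset ℕ) : (sh A).sort (· ≤ ·) = (A.sort (· ≤ ·)).map Nat.succ := by
  rw [sh, ← Finset.map_sort _ _ (· ≤ ·) (· ≤ ·)]
  · rfl
  · intro a _ b _; simp

lemma sort_ins (A : Finset ℕ) :
    (insert 0 (sh A)).sort (· ≤ ·) = 0 :: (A.sort (· ≤ ·)).map Nat.succ := by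
  rw [Finset.sort_insert (r := (· ≤ ·)) (by simp) (zero_notMem_sh _), sort_sh]

lemma Lt_sh (c : ℕ) (B : Finset ℕ) : Lt (c + 1) (sh B) = (Lt c B).map Nat.succ := by
  have : (sh B).filter (fun x => c + 1 ≤ x) = sh (B.filter fun x => c ≤ x) := by
    ext x
    cases x with
    | zero => simp [zero_notMem_sh]
    | succ x => simp [succ_mem_sh]
  rw [Lt, this, sort_sh, Lt, List.map_reverse]

lemma Lt_ins (c : ℕ) (B : Finset ℕ) : Lt (c + 1) (insert 0 (sh B)) = (Lt c B).map Nat.succ := by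
  rw [← Lt_sh, Lt, Lt, filter_insert, if_neg (by simp)]

lemma Lt_top (c K : ℕ) (B : Finset ℕ) (hc : c ≤ K) (hB : ∀ x ∈ B, x < K) :
    Lt c (insert K B) = K :: Lt c B := by
  rw [Lt, filter_insert, if_pos hc, Lt]
  rw [← List.reverse_inj]
  simp only [List.reverse_reverse, List.reverse_cons]
  apply (Finset.sortedLT_sort _).eq_of_mem_iff
  · rw [List.sortedLT_iff_pairwise, List.pairwise_append]
    refine ⟨(Finset.sortedLT_sort _).pairwise, by simp, ?_⟩
    intro a ha b hb
    simp at ha hb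
    subst hb
    exact hB a ha.1
  · intro x
    simp [or_comm]

lemma mem_Lt (c x : ℕ) (B : Finset ℕ) : x ∈ Lt c B ↔ x ∈ B ∧ c ≤ x := by simp [Lt]

lemma nth_inf (B : Finset ℕ) : (Set.ofPred (fun x => x ∉ B)).Infinite := by
  have := B.finite_toSet.infinite_compl
  convert this using 1
  ext x
  simp

lemma SelN_aux (B B' : Finset ℕ) (k d : ℕ) (M : ℕ) (hk : Nat.nth (fun x => x ∉ B') k < M)
    (h : ∀ x < M, x + 1 ∈ B ↔ x ∈ B') (h0 : d = if 0 ∉ B then 1 else 0) :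
    Nat.nth (fun x => x ∉ B) (k + d) = Nat.nth (fun x => x ∉ B') k + 1 := by
  set y := Nat.nth (fun x => x ∉ B') k with hy
  have h1 : y ∉ B' := Nat.nth_mem_of_infinite (nth_inf B') k
  have h2 : Nat.count (fun x => x ∉ B') y = k := Nat.count_nth_of_infinite (nth_inf B') k
  have h3 : Nat.count (fun x => x ∉ B) (y + 1) = k + d := by
    rw [Nat.count_succ', ← h2, h0]
    congr 1
    rw [Nat.count_eq_card_filter_range, Nat.count_eq_card_filter_range]
    congr 1
    apply filter_congr
    intro x hx
    rw [h x ((mem_range.1 hx).trans hk)]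
  rw [← h3]
  exact Nat.nth_count (p := fun x => x ∉ B) (by rw [h y hk]; exact h1)

lemma SelN_ins (B : Finset ℕ) (k : ℕ) : SelN (insert 0 (sh B)) (k + 1) = SelN B (k + 1) + 1 := by
  simp only [SelN, Nat.add_sub_cancel]
  exact SelN_aux _ B k 0 _ (Nat.lt_succ_self _) (by intro x _; simp [succ_mem_sh]) (by simp)

lemma SelN_sh (B : Finset ℕ) (k : ℕ) : SelN (sh B) (k + 1 + 1) = SelN B (k + 1) + 1 := by
  simp only [SelN, Nat.add_sub_cancel]
  exact SelN_aux _ B k 1 _ (Nat.lt_succ_self _) (by intro x _; simp [succ_mem_sh])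
    (by simp [zero_notMem_sh])

lemma SelN_sh_top (B : Finset ℕ) (k K : ℕ) (hB : B ⊆ range K) (hk : k + #B < K) :
    SelN (insert (K + 1) (sh B)) (k + 1 + 1) = SelN B (k + 1) + 1 := by
  simp only [SelN, Nat.add_sub_cancel]
  apply SelN_aux _ B k 1 K
  · apply Nat.nth_lt_of_lt_count
    rw [Nat.count_eq_card_filter_range]
    have : (range K).filter (fun x => x ∉ B) = range K \ B := by
      ext; simp
    rw [this, card_sdiff_of_subset hB, card_range]
    omega
  · intro x hx
    simp [succ_mem_sh]
    omega
  · simp [zero_notMem_sh]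

lemma SelN_one (B : Finset ℕ) (h : 0 ∉ B) : SelN B 1 = 0 := by
  simp only [SelN]
  have := Nat.nth_count (p := fun x => x ∉ B) h
  simpa using this

lemma list_upper (l : List ℕ) (N : ℕ) (hl : l.Pairwise (· < ·)) (hN : ∀ x ∈ l, x < N) (i : ℕ)
    (hi : i < l.length) : l[i] + (l.length - i) ≤ N := by
  induction l generalizing i with
  | nil => simp at hi
  | cons a t ih =>
    rw [List.pairwise_cons] at hl
    cases i with
    | succ i =>
      have := ih hl.2 (fun x hx => hN x (by simp [hx])) i (by simpa using hi)
      simpa using this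
    | zero =>
      cases t with
      | nil => have := hN a (by simp); simp; omega
      | cons b u =>
        have := ih hl.2 (fun x hx => hN x (by simp [hx])) 0 (by simp)
        have h2 := hl.1 b (by simp)
        simp at this ⊢
        omega

lemma list_lower (l : List ℕ) (N : ℕ) (hl : l.Pairwise (· < ·)) (hN : ∀ x ∈ l, N ≤ x) (i : ℕ)
    (hi : i < l.length) : N + i ≤ l[i] := by
  induction l generalizing i N with
  | nil => simp at hi
  | cons a t ih =>
    rw [List.pairwise_cons] at hl
    cases i with
    | succ i =>
      have := ih (N + 1) hl.2 (fun x hx => by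
        have := hl.1 x hx
        have := hN a (by simp)
        omega) i (by simpa using hi)
      simp
      omega
    | zero => simpa using hN a (by simp)

lemma lamA_le (A : Finset ℕ) (n j : ℕ) (hA : A ⊆ range (n + #A)) : lamA A j ≤ n := by
  unfold lamA
  by_cases h : j - 1 < (A.sort (· ≤ ·)).length
  · rw [List.getD_eq_getElem _ _ h]
    have := list_upper (A.sort (· ≤ ·)) (n + #A) (Finset.sortedLT_sort _).pairwise
      (fun x hx => by simpa using hA ((Finset.mem_sort _).1 hx)) _ h
    simp at this h
    omega
  · rw [List.getD_eq_default _ _ (not_lt.1 h)]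
    simp

lemma lamA_sh (A : Finset ℕ) (j : ℕ) (h1 : 1 ≤ j) (hj : j ≤ #A) :
    lamA (sh A) j = lamA A j + 1 := by
  unfold lamA
  have h : j - 1 < (A.sort (· ≤ ·)).length := by simp; omega
  rw [sort_sh, List.getD_eq_getElem _ _ h, List.getD_eq_getElem _ _ (by simpa using h)]
  have := list_lower (A.sort (· ≤ ·)) 0 (Finset.sortedLT_sort _).pairwise (by simp) _ h
  simp
  omega

lemma lamA_ins (A : Finset ℕ) (j : ℕ) : lamA (insert 0 (sh A)) (j + 2) = lamA A (j + 1) := by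
  unfold lamA
  rw [sort_ins]
  simp only [Nat.add_sub_cancel, show j + 2 - 1 = j + 1 by omega, List.getD_cons_succ]
  by_cases h : j < (A.sort (· ≤ ·)).length
  · rw [List.getD_eq_getElem _ _ h, List.getD_eq_getElem _ _ (by simpa using h)]
    simp
  · rw [List.getD_eq_default _ _ (not_lt.1 h),
      List.getD_eq_default _ _ (by simpa using h)]
    simp

lemma lamA_ins_one (A : Finset ℕ) : lamA (insert 0 (sh A)) 1 = 0 := by
  unfold lamA
  rw [sort_ins]
  simp

/-- factor of a top element -/
def fac (j n a b : ℕ) (A B : Finset ℕ) (l x : ℕ) : R :=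
  qv ^ (x - SelN B (lamA A (n + a + b - x) + (l + 1))) *
    Yv (j + SelN B (lamA A (n + a + b - x) + (l + 1)))

/-- weight with shifted indices -/
def wG (i j n a b : ℕ) (A B : Finset ℕ) : R :=
  (∏ x ∈ A, Xv (i + x)) * (∏ x ∈ B.filter (fun x => x < n + b), Yv (j + x)) *
    ∏ l ∈ range (Lt (n + b) B).length, fac j n a b A B l ((Lt (n + b) B).getD l 0)

lemma wWeight_eq (n a b : ℕ) (A B : Finset ℕ) : wWeight n a b A B = wG 0 0 n a b A B := by
  simp only [wWeight, wG, fac, Lt, zero_add]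

lemma prod_sh (f : ℕ → R) (A : Finset ℕ) : ∏ x ∈ sh A, f x = ∏ x ∈ A, f (x + 1) := by
  simp [sh]

lemma prod_ins (f : ℕ → R) (A : Finset ℕ) :
    ∏ x ∈ insert 0 (sh A), f x = f 0 * ∏ x ∈ A, f (x + 1) := by
  rw [prod_insert (zero_notMem_sh _), prod_sh]

lemma filter_sh (B : Finset ℕ) (c : ℕ) :
    (sh B).filter (fun x => x < c + 1) = sh (B.filter fun x => x < c) := by
  ext x
  cases x with
  | zero => simp [zero_notMem_sh]
  | succ x => simp [succ_mem_sh]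

lemma prod_Lt_map (L : List ℕ) (f g : ℕ → ℕ → R)
    (h : ∀ l x, l < L.length → x ∈ L → f l (x + 1) = g l x) :
    ∏ l ∈ range (L.map Nat.succ).length, f l ((L.map Nat.succ).getD l 0) =
      ∏ l ∈ range L.length, g l (L.getD l 0) := by
  rw [List.length_map]
  apply prod_congr rfl
  intro l hl
  have hl' := mem_range.1 hl
  rw [List.getD_eq_getElem _ _ hl', List.getD_eq_getElem _ _ (by simpa using hl')]
  rw [← h l _ hl' (List.getElem_mem hl')]
  simp

lemma wG_L1 (i j n a b : ℕ) (A B : Finset ℕ) :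
    wG i j n a (b + 1) A (insert 0 (sh B)) = Yv j * wG i (j + 1) n a b A B := by
  unfold wG
  rw [← add_assoc, Lt_ins, filter_insert, if_pos (by omega), filter_sh, prod_ins]
  rw [prod_Lt_map (Lt (n + b) B) _ (fac (j + 1) n a b A B)]
  · have hyy : ∀ x, Yv (j + (x + 1)) = Yv (j + 1 + x) := by
      intro x; rw [show j + (x + 1) = j + 1 + x by ring]
    simp only [hyy, add_zero]
    ring
  · intro l x hl hx
    unfold fac
    rw [show n + a + (b + 1) - (x + 1) = n + a + b - x by omega, ← add_assoc, SelN_ins]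
    rw [Nat.add_sub_add_right]
    congr 2
    ring

lemma wG_L2 (i j n a b : ℕ) (A B : Finset ℕ) (hA : #A = a) (hB : B ⊆ range (n + a + b)) :
    wG i j (n + 1) a b (sh A) (sh B) = wG (i + 1) (j + 1) n a b A B := by
  unfold wG
  rw [show n + 1 + b = n + b + 1 by ring, Lt_sh, filter_sh, prod_sh, prod_sh]
  rw [prod_Lt_map (Lt (n + b) B) _ (fac (j + 1) n a b A B)]
  · have hyy : ∀ x, Yv (j + (x + 1)) = Yv (j + 1 + x) := by
      intro x; rw [show j + (x + 1) = j + 1 + x by ring]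
    have hxx : ∀ x, Xv (i + (x + 1)) = Xv (i + 1 + x) := by
      intro x; rw [show i + (x + 1) = i + 1 + x by ring]
    simp only [hyy, hxx]
  · intro l x hl hx
    rw [mem_Lt] at hx
    have hx2 := mem_range.1 (hB hx.1)
    unfold fac
    rw [show n + 1 + a + b - (x + 1) = n + a + b - x by omega,
      lamA_sh _ _ (by omega) (by omega),
      show lamA A (n + a + b - x) + 1 + (l + 1) = lamA A (n + a + b - x) + l + 1 + 1 by ring,
      SelN_sh, Nat.add_sub_add_right, ← add_assoc]
    congr 2
    ring

lemma wG_L3 (i j n a b : ℕ) (A B : Finset ℕ) (hB : B ⊆ range (n + a + b)) :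
    wG i j n (a + 1) b (insert 0 (sh A)) B = Xv i * wG (i + 1) j n a b A B := by
  unfold wG
  rw [prod_ins]
  have h1 : ∏ l ∈ range (Lt (n + b) B).length,
      fac j n (a + 1) b (insert 0 (sh A)) B l ((Lt (n + b) B).getD l 0) =
      ∏ l ∈ range (Lt (n + b) B).length,
        fac j n a b A B l ((Lt (n + b) B).getD l 0) := by
    apply prod_congr rfl
    intro l hl
    have hl' := mem_range.1 hl
    rw [List.getD_eq_getElem _ _ hl']
    have hx := List.getElem_mem hl'
    generalize (Lt (n + b) B)[l] = x at *
    rw [mem_Lt] at hx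
    have hx2 := mem_range.1 (hB hx.1)
    unfold fac
    rw [show n + (a + 1) + b - x = (n + a + b - x - 1) + 2 by omega, lamA_ins,
      show n + a + b - x - 1 + 1 = n + a + b - x by omega]
  rw [h1]
  have hxx : ∀ x, Xv (i + (x + 1)) = Xv (i + 1 + x) := by
    intro x; rw [show i + (x + 1) = i + 1 + x by ring]
  simp only [hxx, add_zero]
  ring

lemma wG_L4 (i j n a b : ℕ) (A B : Finset ℕ) (hA : A ∈ powersetCard a (range (n + a)))
    (hB : B ∈ powersetCard b (range (n + a + b))) :
    wG i j n (a + 1) (b + 1) (insert 0 (sh A)) (insert (n + a + b + 1) (sh B)) =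
      Xv i * Yv j * qv ^ (n + a + b + 1) * wG (i + 1) (j + 1) n a b A B := by
  rw [mem_powersetCard] at hA hB
  obtain ⟨hA, hA2⟩ := hA
  obtain ⟨hB, hB2⟩ := hB
  unfold wG
  have hlt : ∀ x ∈ sh B, x < n + a + b + 1 := by
    intro x hx
    obtain ⟨y, hy, rfl⟩ := (mem_sh _ _).1 hx
    have := mem_range.1 (hB hy)
    omega
  rw [← add_assoc, Lt_top _ _ _ (by omega) hlt, Lt_sh, filter_insert, if_neg (by omega), filter_sh,
    prod_ins, prod_sh, List.length_cons, prod_range_succ']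
  simp only [List.getD_cons_succ, List.getD_cons_zero]
  rw [prod_Lt_map (Lt (n + b) B)
    (fun l x => fac j n (a + 1) (b + 1) (insert 0 (sh A)) (insert (n + a + b + 1) (sh B)) (l + 1) x)
    (fac (j + 1) n a b A B)]
  · have h0 : fac j n (a + 1) (b + 1) (insert 0 (sh A)) (insert (n + a + b + 1) (sh B)) 0
        (n + a + b + 1) = qv ^ (n + a + b + 1) * Yv j := by
      unfold fac
      rw [show n + (a + 1) + (b + 1) - (n + a + b + 1) = 1 by omega, lamA_ins_one, zero_add,
        zero_add, SelN_one]
      · rfl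
      · simp [zero_notMem_sh]
    have hyy : ∀ x, Yv (j + (x + 1)) = Yv (j + 1 + x) := by
      intro x; rw [show j + (x + 1) = j + 1 + x by ring]
    have hxx : ∀ x, Xv (i + (x + 1)) = Xv (i + 1 + x) := by
      intro x; rw [show i + (x + 1) = i + 1 + x by ring]
    simp only [hyy, hxx, add_zero]
    rw [h0]
    ring
  · intro l x hl hx
    rw [mem_Lt] at hx
    have hx2 := mem_range.1 (hB hx.1)
    have hlen : (Lt (n + b) B).length ≤ a := by
      rw [Lt, List.length_reverse, Finset.length_sort]
      have : B.filter (fun x => n + b ≤ x) ⊆ Finset.Ico (n + b) (n + a + b) := by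
        intro y hy
        rw [mem_filter] at hy
        have := mem_range.1 (hB hy.1)
        rw [Finset.mem_Ico]
        omega
      have := card_le_card this
      rw [Nat.card_Ico] at this
      omega
    have hlam := lamA_le A n (n + a + b - x) (by rw [hA2]; exact hA)
    unfold fac
    rw [show n + (a + 1) + (b + 1) - (x + 1) = (n + a + b - x - 1) + 2 by omega, lamA_ins,
      show n + a + b - x - 1 + 1 = n + a + b - x by omega,
      show lamA A (n + a + b - x) + (l + 1 + 1) = lamA A (n + a + b - x) + l + 1 + 1 by ring,
      SelN_sh_top _ _ _ hB (by omega), Nat.add_sub_add_right, ← add_assoc]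
    congr 2
    ring

/-- sum of weights -/
def Ssum (i j n a b : ℕ) : R :=
  ∑ A ∈ powersetCard a (range (n + a)), ∑ B ∈ powersetCard b (range (n + a + b)), wG i j n a b A B

lemma Ssum_zero_zero (i j n : ℕ) : Ssum i j n 0 0 = 1 := by
  simp [Ssum, wG, Lt]

/-- the term coming from `0` in neither set -/
def Sprev (i j n a b : ℕ) : R :=
  match n with
  | 0 => 0
  | n + 1 => Ssum (i + 1) (j + 1) n a b

lemma Sprev_eq (i j n a b : ℕ) (h : 0 < a + b) :
    ∑ A ∈ powersetCard a (range (n + a - 1)), ∑ B ∈ powersetCard b (range (n + a + b - 1)),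
      wG i j n a b (sh A) (sh B) = Sprev i j n a b := by
  cases n with
  | zero =>
    simp only [Sprev]
    rcases Nat.eq_zero_or_pos a with rfl | ha
    · rw [(powersetCard_eq_empty (s := range (0 + 0 + b - 1))).2 (by rw [card_range]; omega)]
      simp
    · rw [(powersetCard_eq_empty (s := range (0 + a - 1))).2 (by rw [card_range]; omega)]
      simp
  | succ n =>
    simp only [Sprev, Ssum]
    rw [show n + 1 + a - 1 = n + a by omega, show n + 1 + a + b - 1 = n + a + b by omega]
    apply sum_congr rfl
    intro A hA
    apply sum_congr rfl
    intro B hB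
    exact wG_L2 _ _ _ _ _ _ _ (mem_powersetCard.1 hA).2 (mem_powersetCard.1 hB).1

lemma Ssum_B (i j n a b : ℕ) : Ssum i j n a (b + 1) = Yv j * Ssum i (j + 1) n a b +
    ∑ A ∈ powersetCard a (range (n + a)), ∑ B ∈ powersetCard (b + 1) (range (n + a + b)),
      wG i j n a (b + 1) A (sh B) := by
  simp only [Ssum]
  rw [← add_assoc]
  simp only [sum_split, sum_add_distrib, wG_L1, mul_sum]

lemma Ssum_a_zero (i j n a : ℕ) :
    Ssum i j n (a + 1) 0 = Sprev i j n (a + 1) 0 + Xv i * Ssum (i + 1) j n a 0 := by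
  rw [← Sprev_eq _ _ _ _ _ (by omega)]
  simp only [Ssum]
  rw [← add_assoc, sum_split, add_comm, mul_sum]
  refine congrArg₂ (· + ·) ?_ ?_
  · simp [sh]
  · apply sum_congr rfl
    intro A hA
    simp only [powersetCard_zero, sum_singleton]
    exact wG_L3 _ _ _ _ _ _ _ (by simp)

lemma Ssum_zero_b (i j n b : ℕ) :
    Ssum i j n 0 (b + 1) = Sprev i j n 0 (b + 1) + Yv j * Ssum i (j + 1) n 0 b := by
  rw [← Sprev_eq _ _ _ _ _ (by omega), Ssum_B, add_comm]
  refine congrArg₂ (· + ·) ?_ rfl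
  simp [sh]

lemma Ssum_succ (i j n a b : ℕ) :
    Ssum i j n (a + 1) (b + 1) = Sprev i j n (a + 1) (b + 1) + Yv j * Ssum i (j + 1) n (a + 1) b +
      Xv i * Ssum (i + 1) j n a (b + 1) +
      Xv i * Yv j * (qv ^ (n + a + b + 1) - 1) * Ssum (i + 1) (j + 1) n a b := by
  rw [← Sprev_eq _ _ _ _ _ (by omega), Ssum_B, Ssum_B (i + 1) j n a b]
  rw [← add_assoc, sum_split]
  have h1 : ∑ A ∈ powersetCard a (range (n + a)),
      ∑ B ∈ powersetCard (b + 1) (range (n + a + 1 + b)),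
        wG i j n (a + 1) (b + 1) (insert 0 (sh A)) (sh B) =
      Xv i * Yv j * qv ^ (n + a + b + 1) * Ssum (i + 1) (j + 1) n a b +
      Xv i * ∑ A ∈ powersetCard a (range (n + a)), ∑ B ∈ powersetCard (b + 1) (range (n + a + b)),
        wG (i + 1) j n a (b + 1) A (sh B) := by
    simp only [Ssum, mul_sum]
    rw [← sum_add_distrib]
    apply sum_congr rfl
    intro A hA
    rw [show n + a + 1 + b = n + a + b + 1 by ring, sum_split_top]
    refine congrArg₂ (· + ·) ?_ ?_
    · apply sum_congr rfl
      intro B hB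
      rw [← wG_L4 _ _ _ _ _ _ _ hA hB]
      congr 1
      simp [sh]
    · apply sum_congr rfl
      intro B hB
      rw [wG_L3]
      intro x hx
      obtain ⟨y, hy, rfl⟩ := (mem_sh _ _).1 hx
      have := mem_range.1 ((mem_powersetCard.1 hB).1 hy)
      rw [mem_range]
      omega
  rw [h1]
  rw [show n + a + 1 - 1 = n + a by omega, show n + a + 1 + (b + 1) - 1 = n + a + 1 + b by omega]
  ring

/-- total sum -/
def Tot (i j n k : ℕ) : R := ∑ p ∈ antidiagonal k, Ssum i j n p.1 p.2

/-- predecessor of total sum in n -/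
def TotP (i j n k : ℕ) : R :=
  match n with
  | 0 => 0
  | n + 1 => Tot (i + 1) (j + 1) n k

lemma Tot_zero (i j n : ℕ) : Tot i j n 0 = 1 := by simp [Tot, Ssum_zero_zero]

lemma TotP_eq (i j n k : ℕ) : ∑ p ∈ antidiagonal k, Sprev i j n p.1 p.2 = TotP i j n k := by
  cases n <;> simp [Sprev, TotP, Tot]

lemma Tot_one (i j n : ℕ) : Tot i j n 1 =
    TotP i j n 1 + Yv j * Tot i (j + 1) n 0 + Xv i * Tot (i + 1) j n 0 := by
  rw [← TotP_eq]
  simp only [Tot, Nat.sum_antidiagonal_succ, Nat.antidiagonal_zero, sum_singleton, zero_add]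
  rw [← zero_add 1, Ssum_a_zero, Ssum_zero_b]
  ring

lemma Tot_succ (i j n k : ℕ) : Tot i j n (k + 2) =
    TotP i j n (k + 2) + Yv j * Tot i (j + 1) n (k + 1) + Xv i * Tot (i + 1) j n (k + 1) +
      Xv i * Yv j * (qv ^ (n + k + 1) - 1) * Tot (i + 1) (j + 1) n k := by
  rw [← TotP_eq]
  simp only [Tot]
  have e : ∀ f : ℕ × ℕ → R, ∑ p ∈ antidiagonal (k + 2), f p =
      f (0, k + 2) + f (k + 2, 0) + ∑ p ∈ antidiagonal k, f (p.1 + 1, p.2 + 1) := by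
    intro f
    rw [Nat.sum_antidiagonal_succ, Nat.sum_antidiagonal_succ']
    ring
  rw [e, e, Nat.sum_antidiagonal_succ (n := k) (f := fun p => Ssum i (j + 1) n p.1 p.2),
    Nat.sum_antidiagonal_succ' (n := k) (f := fun p => Ssum (i + 1) j n p.1 p.2)]
  simp only [Ssum_succ]
  rw [show k + 2 = k + 1 + 1 by ring, Ssum_a_zero, Ssum_zero_b]
  have : ∑ p ∈ antidiagonal k, Xv i * Yv j * (qv ^ (n + p.1 + p.2 + 1) - 1) *
      Ssum (i + 1) (j + 1) n p.1 p.2 = Xv i * Yv j * (qv ^ (n + k + 1) - 1) *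
      ∑ p ∈ antidiagonal k, Ssum (i + 1) (j + 1) n p.1 p.2 := by
    rw [mul_sum]
    apply sum_congr rfl
    intro p hp
    rw [HasAntidiagonal.mem_antidiagonal] at hp
    rw [add_assoc n, hp]
  simp only [sum_add_distrib, this, ← mul_sum]
  ring

section poly
variable {K : Type*} [CommRing K]

/-- auxiliary q-number -/
def qn (q : K) : ℕ → K
  | 0 => 0
  | n + 1 => 1 + q * qn q n

lemma pow_qn (q : K) (n : ℕ) : q ^ n = 1 + (q - 1) * qn q n := by
  induction n with
  | zero => simp [qn]
  | succ n ih => rw [pow_succ, ih, qn]; ring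

/-- generic Al-Salam-Chihara recurrence, with value at `x` -/
def PP (q e f x : K) (α β : K) : ℕ → K
  | 0 => 1
  | 1 => x + (α + β)
  | n + 2 => (x + ((α + β) * q ^ (n + 1) + (e + f) * qn q (n + 1))) * PP q e f x α β (n + 1)
      - (e * f * qn q (n + 1) * qn q n + (α * f + β * e) * q ^ n * qn q (n + 1)
    + α * β * (q ^ (2 * n + 1) - q ^ n)) * PP q e f x α β n

lemma PP_R1 (q e f x α β : K) (n : ℕ) : PP q e f x α β (n + 1) =
    PP q e f x (α * q + e) β (n + 1) +
      (α - (α * q + e)) * qn q (n + 1) * PP q e f x (α * q + e) β n := by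
  induction n using Nat.strong_induction_on with
  | _ n ih =>
  match n, ih with
  | 0, _ => simp [PP, qn]; ring
  | 1, _ => simp [PP, qn]; ring
  | n + 2, ih =>
    have h1 := ih (n + 1) (by omega)
    have h0 := ih n (by omega)
    rw [PP, h1, h0]
    rw [PP.eq_3 q e f x (α * q + e) β (n + 1), PP.eq_3 q e f x (α * q + e) β n]
    have e2 : q ^ (2 * (n + 1) + 1) = q ^ n * q ^ n * q ^ 3 := by ring
    have e3 : q ^ (2 * n + 1) = q ^ n * q ^ n * q := by ring
    simp only [e2, e3, pow_succ, qn, pow_qn q n]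
    ring

lemma PP_symm (q e f x α β : K) (n : ℕ) : PP q e f x α β n = PP q f e x β α n := by
  induction n using Nat.strong_induction_on with
  | _ n ih =>
  match n, ih with
  | 0, _ => simp [PP]
  | 1, _ => simp [PP]; ring
  | n + 2, ih =>
    rw [PP, PP, ih (n + 1) (by omega), ih n (by omega)]
    ring

lemma PP_R2 (q e f x α β : K) (n : ℕ) : PP q e f x α β (n + 1) =
    PP q e f x α (β * q + f) (n + 1) +
      (β - (β * q + f)) * qn q (n + 1) * PP q e f x α (β * q + f) n := by
  rw [PP_symm, PP_R1, PP_symm, PP_symm q f e x _ _ n]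

lemma PP_one (q e f x α β : K) : PP q e f x α β 1 =
    α * PP q e f x (α * q + e) β 0 + β * PP q e f x α (β * q + f) 0 +
      x * PP q e f x (α * q + e) (β * q + f) 0 := by
  simp [PP]; ring

lemma PP_star (q e f x α β : K) (n : ℕ) : PP q e f x α β (n + 2) =
    α * PP q e f x (α * q + e) β (n + 1) + β * PP q e f x α (β * q + f) (n + 1) +
      α * β * (q ^ (n + 1) - 1) * PP q e f x (α * q + e) (β * q + f) n +
      x * PP q e f x (α * q + e) (β * q + f) (n + 1) := by
  rw [PP_R1 q e f x α β (n + 1), PP_R2 q e f x (α * q + e) β (n + 1),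
    PP_R2 q e f x (α * q + e) β n, PP_R1 q e f x α (β * q + f) n,
    PP.eq_3 q e f x (α * q + e) (β * q + f) n]
  have e3 : q ^ (2 * n + 1) = q ^ n * q ^ n * q := by ring
  simp only [e3, pow_succ, qn, pow_qn q n]
  ring

end poly

lemma qnum_eq (n : ℕ) : qnum n = qn qv n := by
  induction n with
  | zero => simp [qnum, qn]
  | succ n ih =>
    rw [qn, ← ih, qnum, qnum, sum_range_succ', mul_sum]
    simp only [pow_succ, pow_zero]
    rw [add_comm]
    congr 1
    apply sum_congr rfl
    intro x _
    ring

open Polynomial in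
/-- the shifted polynomials -/
def PX (i j n : ℕ) : Polynomial R :=
  PP (C qv) (C e1v) (C e2v) X (C (Xv i)) (C (Yv j)) n

lemma qn_C (n : ℕ) : qn (Polynomial.C qv) n = Polynomial.C (qn qv n) := by
  induction n with
  | zero => simp [qn]
  | succ n ih => simp [qn, ih]

lemma phat_eq (n : ℕ) : phat n = PX 0 0 n := by
  have hX : Xv 0 = av := by simp [Xv, qnum]
  have hY : Yv 0 = bv := by simp [Yv, qnum]
  unfold PX
  rw [hX, hY]
  induction n using Nat.strong_induction_on with
  | _ n ih =>
  match n, ih with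
  | 0, _ => simp [PP, phat]
  | 1, _ => simp [PP, phat, bcoef, qnum]
  | n + 2, ih =>
    rw [PP, phat, ih (n + 1) (by omega), ih n (by omega)]
    simp only [bcoef, lcoef, qnum_eq, qn_C, Nat.add_sub_cancel,
      show 2 * (n + 1) - 1 = 2 * n + 1 by omega, map_add, map_mul, map_sub, map_pow]

lemma Xv_succ (i : ℕ) : Xv (i + 1) = Xv i * qv + e1v := by
  simp only [Xv, qnum_eq, qn]; ring

lemma Yv_succ (i : ℕ) : Yv (i + 1) = Yv i * qv + e2v := by
  simp only [Yv, qnum_eq, qn]; ring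

open Polynomial in
lemma PX_star (i j n : ℕ) : PX i j (n + 2) =
    C (Xv i) * PX (i + 1) j (n + 1) + C (Yv j) * PX i (j + 1) (n + 1) +
      C (Xv i * Yv j * (qv ^ (n + 1) - 1)) * PX (i + 1) (j + 1) n +
      X * PX (i + 1) (j + 1) (n + 1) := by
  unfold PX
  rw [PP_star]
  simp only [Xv_succ, Yv_succ, map_add, map_mul, map_sub, map_pow, map_one]

open Polynomial in
lemma PX_one (i j : ℕ) : PX i j 1 =
    C (Xv i) * PX (i + 1) j 0 + C (Yv j) * PX i (j + 1) 0 + X * PX (i + 1) (j + 1) 0 := by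
  unfold PX
  rw [PP_one]
  simp only [Xv_succ, Yv_succ, map_add, map_mul]

lemma PX_zero (i j : ℕ) : PX i j 0 = 1 := rfl

lemma PX_coeff_gt (m : ℕ) : ∀ i j n, m < n → (PX i j m).coeff n = 0 := by
  induction m using Nat.strong_induction_on with
  | _ m ih =>
  intro i j n hn
  obtain ⟨n, rfl⟩ : ∃ n', n = n' + 1 := ⟨n - 1, by omega⟩
  match m, ih with
  | 0, _ => simp [PX_zero, Polynomial.coeff_one]
  | 1, ih =>
    rw [PX_one]
    simp only [Polynomial.coeff_add, Polynomial.coeff_C_mul, Polynomial.coeff_X_mul]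
    rw [ih 0 (by omega) _ _ _ (by omega), ih 0 (by omega) _ _ _ (by omega),
      ih 0 (by omega) _ _ _ (by omega)]
    ring
  | m + 2, ih =>
    rw [PX_star]
    simp only [Polynomial.coeff_add, Polynomial.coeff_C_mul, Polynomial.coeff_X_mul]
    rw [ih (m + 1) (by omega) _ _ _ (by omega), ih (m + 1) (by omega) _ _ _ (by omega),
      ih m (by omega) _ _ _ (by omega), ih (m + 1) (by omega) _ _ _ (by omega)]
    ring

lemma coeff_main (m : ℕ) : ∀ i j n k, n + k = m → (PX i j m).coeff n = Tot i j n k := by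
  induction m using Nat.strong_induction_on with
  | _ m ih =>
  intro i j n k hnk
  have hx : ∀ m', m = m' + 1 → (Polynomial.X * PX (i + 1) (j + 1) m').coeff n =
      TotP i j n k := by
    intro m' hm'
    cases n with
    | zero => simp [TotP]
    | succ n =>
      rw [Polynomial.coeff_X_mul, ih m' (by omega) _ _ n k (by omega)]
      rfl
  match m, ih, hnk, hx with
  | 0, _, hnk, _ =>
    obtain ⟨rfl, rfl⟩ : n = 0 ∧ k = 0 := by omega
    simp [PX_zero, Tot_zero]
  | 1, ih, hnk, hx =>
    rw [PX_one]
    simp only [Polynomial.coeff_add, Polynomial.coeff_C_mul]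
    rw [hx 0 rfl]
    cases k with
    | zero =>
      rw [PX_coeff_gt _ _ _ _ (by omega), PX_coeff_gt _ _ _ _ (by omega), Tot_zero]
      obtain rfl : n = 1 := by omega
      simp [TotP, Tot_zero]
    | succ k =>
      obtain ⟨rfl, rfl⟩ : n = 0 ∧ k = 0 := by omega
      rw [ih 0 (by omega) _ _ 0 0 (by omega), ih 0 (by omega) _ _ 0 0 (by omega), Tot_one]
      ring
  | m + 2, ih, hnk, hx =>
    rw [PX_star]
    simp only [Polynomial.coeff_add, Polynomial.coeff_C_mul]
    rw [hx (m + 1) rfl]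
    match k, hnk, hx with
    | 0, hnk, hx =>
      rw [PX_coeff_gt _ _ _ _ (by omega), PX_coeff_gt _ _ _ _ (by omega),
        PX_coeff_gt _ _ _ _ (by omega), Tot_zero]
      obtain rfl : n = m + 1 + 1 := by omega
      simp [TotP, Tot_zero]
    | 1, hnk, hx =>
      rw [PX_coeff_gt m _ _ _ (by omega), ih (m + 1) (by omega) _ _ n 0 (by omega),
        ih (m + 1) (by omega) _ _ n 0 (by omega), Tot_one]
      ring
    | k + 2, hnk, hx =>
      rw [ih m (by omega) _ _ n k (by omega), ih (m + 1) (by omega) _ _ n (k + 1) (by omega),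
        ih (m + 1) (by omega) _ _ n (k + 1) (by omega), Tot_succ]
      obtain rfl : m = n + k := by omega
      ring

/-- **Theorem `main2`.** The coefficient `g_{n+k,n}` of `x^n` in `p̂_{n+k}(x)`
is the weighted sum over all pairs `(A,B)` with `A ⊆ {0,…,n+a−1}`, `|A| = a`,
`B ⊆ {0,…,n+a+b−1}`, `|B| = b`, over all `a + b = k`, with weight `w_n(A,B)`. -/
theorem second_formula_coefficients (n k : ℕ) :
    g (n + k) n =
      ∑ a ∈ Finset.range (k + 1),
        ∑ A ∈ Finset.powersetCard a (Finset.range (n + a)),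
          ∑ B ∈ Finset.powersetCard (k - a) (Finset.range (n + k)),
            wWeight n a (k - a) A B := by
  rw [g, phat_eq, coeff_main (n + k) 0 0 n k rfl, Tot,
    Nat.sum_antidiagonal_eq_sum_range_succ_mk]
  apply sum_congr rfl
  intro a ha
  have ha' := mem_range.1 ha
  simp only [Ssum, wWeight_eq]
  rw [show n + a + (k - a) = n + k by omega]
end
end

section
/- Let g_{k,0} denote the constant coefficient of the transformed Al-Salam–Chihara polynomial p̂_k(x). Then for all k ≥ 0, g_{k,0} = Σ_{i=0}^{k} binom_q(k,i) · X₀⋯X_{i−1} · Y₀⋯Y_{k−i−1} (empty products equal 1). -/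
noncomputable section

open Finset

lemma qnum_add (m n : ℕ) : qnum (m + n) = qnum m + qv ^ m * qnum n := by
  simp only [qnum, Finset.sum_range_add, Finset.mul_sum, pow_add]

lemma qnum_zero' : qnum 0 = 0 := by simp [qnum]
lemma qnum_one' : qnum 1 = 1 := by simp [qnum]

lemma qnum_geom (n : ℕ) : (qv - 1) * qnum n = qv ^ n - 1 := by
  rw [qnum, mul_comm]; exact geom_sum_mul qv n

lemma qbinom_zero_right' (n : ℕ) : qbinom n 0 = 1 := by cases n <;> rfl

lemma qbinom_lt (n : ℕ) : ∀ k, n < k → qbinom n k = 0 := by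
  induction n with
  | zero => intro k hk; obtain ⟨k, rfl⟩ : ∃ m, k = m + 1 := ⟨k - 1, by omega⟩; rfl
  | succ n ih =>
    intro k hk
    obtain ⟨k, rfl⟩ : ∃ m, k = m + 1 := ⟨k - 1, by omega⟩
    rw [qbinom, ih k (by omega), ih (k + 1) (by omega)]; ring

/-- symmetric indexing of the Gaussian binomial -/
def cc (i j : ℕ) : R := qbinom (i + j) i

lemma cc_zero_left (j : ℕ) : cc 0 j = 1 := qbinom_zero_right' _

lemma cc_zero_right (i : ℕ) : cc i 0 = 1 := by
  induction i with
  | zero => exact cc_zero_left 0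
  | succ i ih =>
    have h : cc (i + 1) 0 = cc i 0 + qv ^ (i + 1) * qbinom i (i + 1) := rfl
    rw [h, ih, qbinom_lt i (i + 1) (by omega)]; ring

lemma cc_succ (i j : ℕ) : cc (i + 1) (j + 1) = cc i (j + 1) + qv ^ (i + 1) * cc (i + 1) j := by
  unfold cc
  rw [show i + 1 + (j + 1) = (i + j + 1) + 1 by ring, qbinom,
    show i + (j + 1) = i + j + 1 by ring, show i + 1 + j = i + j + 1 by ring]

lemma absorb (s : ℕ) : ∀ i j, i + j = s →
    qnum (i + 1) * cc (i + 1) j = qnum (i + j + 1) * cc i j ∧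
    qnum (j + 1) * cc i (j + 1) = qnum (i + j + 1) * cc i j := by
  induction s with
  | zero =>
    intro i j h
    obtain ⟨rfl, rfl⟩ : i = 0 ∧ j = 0 := by omega
    simp [cc_zero_left, cc_zero_right]
  | succ s ih =>
    intro i j h
    constructor
    · cases j with
      | zero => simp [cc_zero_right]
      | succ j =>
        obtain ⟨h1, h2⟩ := ih i j (by omega)
        have e := qnum_add (i + 1) (j + 1)
        rw [show i + (j + 1) + 1 = i + 1 + (j + 1) by ring, cc_succ, e]
        linear_combination qv ^ (i + 1) * h1 - qv ^ (i + 1) * h2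
    · cases i with
      | zero => simp [cc_zero_left]
      | succ i =>
        obtain ⟨h1, h2⟩ := ih i j (by omega)
        have e := qnum_add (i + 1) (j + 1)
        rw [show i + 1 + j + 1 = i + 1 + (j + 1) by ring, cc_succ, e]
        linear_combination h2 - h1

def Ap (i : ℕ) : R := ∏ t ∈ Finset.range i, Xv t
def Bp (i : ℕ) : R := ∏ t ∈ Finset.range i, Yv t
lemma Ap_succ (i : ℕ) : Ap (i + 1) = Ap i * Xv i := Finset.prod_range_succ _ _
lemma Bp_succ (i : ℕ) : Bp (i + 1) = Bp i * Yv i := Finset.prod_range_succ _ _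

def Ss (n : ℕ) : R := ∑ p ∈ Finset.HasAntidiagonal.antidiagonal n, cc p.1 p.2 * Ap p.1 * Bp p.2

def uu : ℕ → ℕ → R
  | 0, _ => 0
  | i + 1, j => cc i j
def vv : ℕ → ℕ → R
  | _, 0 => 0
  | i, j + 1 => qv ^ i * cc i j

lemma cc_split (i j : ℕ) (h : i + j ≠ 0) : cc i j = uu i j + vv i j := by
  cases i with
  | zero =>
    cases j with
    | zero => omega
    | succ j => simp [uu, vv, cc_zero_left]
  | succ i =>
    cases j with
    | zero => simp [uu, vv, cc_zero_right]
    | succ j => exact cc_succ i j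

lemma Ss_succ (n : ℕ) : Ss (n + 1) = ∑ p ∈ Finset.HasAntidiagonal.antidiagonal n,
    cc p.1 p.2 * Ap p.1 * Bp p.2 * (Xv p.1 + qv ^ p.1 * Yv p.2) := by
  have h : Ss (n + 1) = ∑ p ∈ Finset.HasAntidiagonal.antidiagonal (n + 1), uu p.1 p.2 * Ap p.1 * Bp p.2
      + ∑ p ∈ Finset.HasAntidiagonal.antidiagonal (n + 1), vv p.1 p.2 * Ap p.1 * Bp p.2 := by
    rw [Ss, ← Finset.sum_add_distrib]
    refine Finset.sum_congr rfl fun p hp => ?_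
    rw [Finset.HasAntidiagonal.mem_antidiagonal] at hp
    rw [cc_split p.1 p.2 (by omega)]; ring
  rw [h, Finset.Nat.sum_antidiagonal_succ, Finset.Nat.sum_antidiagonal_succ']
  simp only [uu, vv, zero_mul, zero_add, add_zero]
  rw [← Finset.sum_add_distrib]
  refine Finset.sum_congr rfl fun p _ => ?_
  rw [Ap_succ, Bp_succ]; ring

lemma Xv_add (i j : ℕ) :
    Xv (i + j) = Xv i + qv ^ i * qnum j * (av * (qv - 1) + e1v) := by
  unfold Xv; rw [qnum_add, pow_add]
  linear_combination (-av * qv ^ i) * qnum_geom j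

lemma Yv_add (i j : ℕ) : Yv (i + j) = qv ^ i * Yv j + e2v * qnum i := by
  unfold Yv; rw [qnum_add, pow_add]; ring

lemma lcoef_eq (n : ℕ) : lcoef (n + 1) =
    qnum (n + 1) * ((av * (qv - 1) + e1v) * Yv n + e2v * av) := by
  unfold lcoef Yv
  rw [show n + 1 - 1 = n by omega, show 2 * (n + 1) - 1 = n + (n + 1) by omega, pow_add]
  linear_combination (-av * bv * qv ^ n) * qnum_geom (n + 1)
    - (av * e2v * qnum (n + 1)) * qnum_geom n

lemma sum_j (n : ℕ) : ∑ p ∈ Finset.HasAntidiagonal.antidiagonal (n + 1),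
      qv ^ p.1 * (qnum p.2 * cc p.1 p.2) * Ap p.1 * Bp p.2
    = qnum (n + 1) * ∑ p ∈ Finset.HasAntidiagonal.antidiagonal n,
      cc p.1 p.2 * Ap p.1 * Bp p.2 * (qv ^ p.1 * Yv p.2) := by
  rw [Finset.Nat.sum_antidiagonal_succ', Finset.mul_sum]
  simp only [qnum_zero', zero_mul, mul_zero, zero_add, add_zero]
  refine Finset.sum_congr rfl fun p hp => ?_
  rw [Finset.HasAntidiagonal.mem_antidiagonal] at hp
  rw [(absorb n p.1 p.2 hp).2, hp, Bp_succ]; ring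

lemma sum_i (n : ℕ) : ∑ p ∈ Finset.HasAntidiagonal.antidiagonal (n + 1),
      (qnum p.1 * cc p.1 p.2) * Ap p.1 * Bp p.2
    = qnum (n + 1) * ∑ p ∈ Finset.HasAntidiagonal.antidiagonal n,
      cc p.1 p.2 * Ap p.1 * Bp p.2 * Xv p.1 := by
  rw [Finset.Nat.sum_antidiagonal_succ, Finset.mul_sum]
  simp only [qnum_zero', zero_mul, mul_zero, zero_add, add_zero]
  refine Finset.sum_congr rfl fun p hp => ?_
  rw [Finset.HasAntidiagonal.mem_antidiagonal] at hp
  rw [(absorb n p.1 p.2 hp).1, hp, Ap_succ]; ring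

lemma Ss_rec (n : ℕ) : Ss (n + 2) = bcoef (n + 1) * Ss (n + 1) - lcoef (n + 1) * Ss n := by
  have h1 : bcoef (n + 1) * Ss (n + 1) - Ss (n + 2)
      = (av * (qv - 1) + e1v) * (∑ p ∈ Finset.HasAntidiagonal.antidiagonal (n + 1),
          qv ^ p.1 * (qnum p.2 * cc p.1 p.2) * Ap p.1 * Bp p.2)
        + e2v * ∑ p ∈ Finset.HasAntidiagonal.antidiagonal (n + 1),
          (qnum p.1 * cc p.1 p.2) * Ap p.1 * Bp p.2 := by
    rw [Ss_succ (n + 1), Ss, Finset.mul_sum, Finset.mul_sum, Finset.mul_sum,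
      ← Finset.sum_sub_distrib, ← Finset.sum_add_distrib]
    refine Finset.sum_congr rfl fun p hp => ?_
    rw [Finset.HasAntidiagonal.mem_antidiagonal] at hp
    have hb : bcoef (n + 1) = Xv (n + 1) + Yv (n + 1) := by
      unfold bcoef Xv Yv; ring
    rw [hb, ← hp, Xv_add, Yv_add]; ring
  have h2 : lcoef (n + 1) * Ss n
      = (av * (qv - 1) + e1v) * (qnum (n + 1) * ∑ p ∈ Finset.HasAntidiagonal.antidiagonal n,
          cc p.1 p.2 * Ap p.1 * Bp p.2 * (qv ^ p.1 * Yv p.2))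
        + e2v * (qnum (n + 1) * ∑ p ∈ Finset.HasAntidiagonal.antidiagonal n,
          cc p.1 p.2 * Ap p.1 * Bp p.2 * Xv p.1) := by
    simp only [Ss, Finset.mul_sum]
    rw [← Finset.sum_add_distrib]
    refine Finset.sum_congr rfl fun p hp => ?_
    rw [Finset.HasAntidiagonal.mem_antidiagonal] at hp
    rw [lcoef_eq, ← hp, Yv_add]
    unfold Xv
    linear_combination (qnum (p.1 + p.2 + 1) * cc p.1 p.2 * Ap p.1 * Bp p.2 * e2v * av) *
      qnum_geom p.1
  rw [sum_j, sum_i, ← h2] at h1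
  linear_combination -h1

lemma g_eq_Ss (k : ℕ) : g k 0 = Ss k ∧ g (k + 1) 0 = Ss (k + 1) := by
  induction k with
  | zero =>
    constructor
    · simp [g, phat, Ss, cc_zero_left, Ap, Bp]
    · rw [Ss_succ]
      simp [g, phat, cc_zero_left, Ap, Bp, bcoef, Xv, Yv, qnum_zero']
  | succ k ih =>
    refine ⟨ih.2, ?_⟩
    rw [Ss_rec, ← ih.1, ← ih.2]
    simp [g, phat, Polynomial.mul_coeff_zero]

/-- For all `k ≥ 0`,
`g_{k,0} = Σ_{i=0}^{k} binom_q(k,i) · X₀⋯X_{i−1} · Y₀⋯Y_{k−i−1}`. -/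
theorem constant_coefficient_formula (k : ℕ) :
    g k 0 = ∑ i ∈ Finset.range (k + 1),
      qbinom k i * (∏ t ∈ Finset.range i, Xv t) * ∏ t ∈ Finset.range (k - i), Yv t := by
  rw [(g_eq_Ss k).1, Ss, Finset.Nat.sum_antidiagonal_eq_sum_range_succ_mk]
  refine Finset.sum_congr rfl fun i hi => ?_
  have hi' : i + (k - i) = k := by
    rw [Finset.mem_range] at hi; omega
  simp only [cc, Ap, Bp, hi']
end
end
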